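/- Strict version of Theorem 1. Let f_X be a log-concave density symmetric about its mean μ, and let f and g be quasi-concave densities symmetric about 0 such that g is strictly less precise than f, i.e., x ↦ g(x)/f(x) is strictly increasing on (0,∞). Then for every signal realization s > μ, E_f[X|S=s] > E_g[X|S=s] ≥ μ, and for every s < μ, E_f[X|S=s] < E_g[X|S=s] ≤ μ, where E_h[X|S=s] denotes the posterior mean under prior f_X and noise density h. -/

import Mathlib

open MeasureTheory Real Set

noncomputable section

/-- A density: everywhere positive, continuously differentiable, integrates to 1,
with finite first absolute moment. -/
def IsDensity (f : ℝ → ℝ) : Prop :=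
  (∀ x, 0 < f x) ∧ ContDiff ℝ 1 f ∧ (∫ x, f x) = 1 ∧
    MeasureTheory.Integrable (fun x => |x| * f x)

/-- `f` is symmetric about `m`. -/
def SymmAbout (m : ℝ) (f : ℝ → ℝ) : Prop := ∀ x, f (m + x) = f (m - x)

/-- `f` is quasi-concave. -/
def QuasiConcaveFn (f : ℝ → ℝ) : Prop :=
  ∀ x y t : ℝ, 0 ≤ t → t ≤ 1 → min (f x) (f y) ≤ f (t * x + (1 - t) * y)

/-- `f` is log-concave. -/
def LogConcaveFn (f : ℝ → ℝ) : Prop := ConcaveOn ℝ Set.univ fun x => Real.log (f x)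

/-- `g` is less precise than `f`: the ratio `g/f` is nondecreasing on `(0, ∞)`. -/
def LessPrecise (g f : ℝ → ℝ) : Prop := MonotoneOn (fun x => g x / f x) (Set.Ioi 0)

/-- Posterior mean at signal realization `s` under prior `fX` and noise density `fε`. -/
def postMean (fX fε : ℝ → ℝ) (s : ℝ) : ℝ :=
  (∫ x, x * fX x * fε (s - x)) / (∫ x, fX x * fε (s - x))

theorem IsDensity.integrable {f : ℝ → ℝ} (hf : IsDensity f) : Integrable f :=
  integrable_of_integral_eq_one hf.2.2.1

theorem IsDensity.continuous {f : ℝ → ℝ} (hf : IsDensity f) : Continuous f :=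
  hf.2.1.continuous

theorem IsDensity.integrable_id_mul {f : ℝ → ℝ} (hf : IsDensity f) :
    Integrable fun x => x * f x := by
  refine hf.2.2.2.mono (continuous_id.mul hf.continuous).aestronglyMeasurable ?_
  filter_upwards with x
  simp

theorem SymmAbout.neg_eq {h : ℝ → ℝ} (hh : SymmAbout 0 h) (x : ℝ) : h (-x) = h x := by
  simpa using (hh x).symm

/-- A symmetric quasi-concave function decreases away from its centre. -/
theorem QuasiConcaveFn.le_of_abs_le {h : ℝ → ℝ} (hq : QuasiConcaveFn h) (hs : SymmAbout 0 h)
    {x y : ℝ} (hxy : |x| ≤ y) : h y ≤ h x := by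
  obtain ⟨h1, h2⟩ := abs_le.mp hxy
  rcases (abs_nonneg x |>.trans hxy).eq_or_lt with rfl | hy
  · have : x = 0 := by linarith
    rw [this]
  · have key := hq y (-y) ((x / y + 1) / 2) (by
      have : -1 ≤ x / y := by rw [le_div_iff₀ hy]; linarith
      linarith) (by
      have : x / y ≤ 1 := by rw [div_le_iff₀ hy]; linarith
      linarith)
    rw [hs.neg_eq, min_self] at key
    convert key using 2
    field_simp
    ring

/-- For a log-concave function symmetric about `μ ≤ s`, the ratio `p (s + y) / p (s - y)` is
nonincreasing in `y`. -/
theorem LogConcaveFn.mul_le_mul {p : ℝ → ℝ} {μ s y y' : ℝ} (hp : LogConcaveFn p)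
    (hpos : ∀ x, 0 < p x) (hsym : SymmAbout μ p) (hs : μ ≤ s) (hy : y ≤ y') :
    p (s + y') * p (s - y) ≤ p (s + y) * p (s - y') := by
  have hr : ∀ z, p (s - z) = p (2 * μ - s + z) := fun z => by
    have := hsym (s - z - μ)
    convert this using 2 <;> ring
  rw [hr, hr, ← Real.log_le_log_iff (mul_pos (hpos _) (hpos _)) (mul_pos (hpos _) (hpos _)),
    Real.log_mul (hpos _).ne' (hpos _).ne', Real.log_mul (hpos _).ne' (hpos _).ne']
  rcases hs.eq_or_lt with rfl | hs
  · ring_nf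
    linarith
  set a := 2 * μ - s + y with ha
  set b := s + y' with hb
  have hab : 0 < b - a := by linarith
  set t := 2 * (s - μ) / (b - a) with ht
  have ht0 : 0 ≤ t := by positivity
  have ht1 : t ≤ 1 := by rw [ht, div_le_one hab]; linarith
  have htm : t * (b - a) = 2 * (s - μ) := div_mul_cancel₀ _ hab.ne'
  have h1 := hp.2 (mem_univ a) (mem_univ b) (sub_nonneg.2 ht1) ht0 (by ring)
  have h2 := hp.2 (mem_univ a) (mem_univ b) ht0 (sub_nonneg.2 ht1) (by ring)
  simp only [smul_eq_mul] at h1 h2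
  rw [show (1 - t) * a + t * b = s + y by linear_combination htm + ha] at h1
  rw [show t * a + (1 - t) * b = 2 * μ - s + y' by linear_combination -htm + hb] at h2
  linarith

section Posterior

variable {p h : ℝ → ℝ} {μ s : ℝ}

theorem integrable_mul_noise {u : ℝ → ℝ} (hu : Integrable u) (hh : IsDensity h)
    (hsym : SymmAbout 0 h) (hq : QuasiConcaveFn h) (s : ℝ) :
    Integrable fun x => u x * h (s - x) := by
  refine hu.mul_bdd (c := h 0)
    (hh.continuous.comp (continuous_const.sub continuous_id)).aestronglyMeasurable ?_
  filter_upwards with x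
  rw [Real.norm_of_nonneg (hh.1 _).le]
  rcases abs_cases (s - x) with ⟨he, h0⟩ | ⟨he, h0⟩
  · exact hq.le_of_abs_le hsym (by simpa using h0)
  · rw [← hsym.neg_eq]
    exact hq.le_of_abs_le hsym (by simp; linarith)

/-- Integrals against the noise density can be symmetrized around the signal. -/
theorem integral_symmetrized {u : ℝ → ℝ} (hu : Integrable u) (hh : IsDensity h)
    (hsym : SymmAbout 0 h) (hq : QuasiConcaveFn h) (s : ℝ) :
    Integrable (fun y => (u (s + y) + u (s - y)) * h y) ∧
      ∫ y, (u (s + y) + u (s - y)) * h y = 2 * ∫ x, u x * h (s - x) := by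
  have hi := integrable_mul_noise hu hh hsym hq s
  have i1 : Integrable fun y => u (s - y) * h y := by
    simpa using hi.comp_sub_left s
  have i2 : Integrable fun y => u (s + y) * h y := by
    simpa [hsym.neg_eq] using hi.comp_add_left s
  have e1 : ∫ y, u (s - y) * h y = ∫ x, u x * h (s - x) := by
    simpa using integral_sub_left_eq_self (fun x => u x * h (s - x)) volume s
  have e2 : ∫ y, u (s + y) * h y = ∫ x, u x * h (s - x) := by
    simpa [hsym.neg_eq] using integral_add_left_eq_self (μ := volume) (fun x => u x * h (s - x)) s
  simp only [add_mul]
  refine ⟨i2.add i1, ?_⟩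
  rw [integral_add i2 i1, e1, e2]
  ring

theorem integral_mul_noise_pos (hp : IsDensity p) (hh : IsDensity h)
    (hsym : SymmAbout 0 h) (hq : QuasiConcaveFn h) (s : ℝ) :
    0 < ∫ x, p x * h (s - x) :=
  integral_pos_of_integrable_nonneg_nonzero (x := 0)
    (hp.continuous.mul (hh.continuous.comp (continuous_const.sub continuous_id)))
    (integrable_mul_noise hp.integrable hh hsym hq s)
    (fun _ => (mul_pos (hp.1 _) (hh.1 _)).le) (mul_pos (hp.1 _) (hh.1 _)).ne'

theorem integral_symmetrized_density (hp : IsDensity p) (hh : IsDensity h)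
    (hsym : SymmAbout 0 h) (hq : QuasiConcaveFn h) (s : ℝ) :
    Integrable (fun y => (p (s + y) + p (s - y)) * h y) ∧
      0 < ∫ y, (p (s + y) + p (s - y)) * h y := by
  obtain ⟨i, e⟩ := integral_symmetrized hp.integrable hh hsym hq s
  refine ⟨i, ?_⟩
  rw [e]
  linarith [integral_mul_noise_pos hp hh hsym hq s]

/-- The posterior mean as the signal plus an average against a symmetric weight. -/
theorem postMean_eq_add_div (hp : IsDensity p) (hh : IsDensity h)
    (hsym : SymmAbout 0 h) (hq : QuasiConcaveFn h) (s : ℝ) :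
    Integrable (fun y => y * (p (s + y) - p (s - y)) * h y) ∧
      postMean p h s = s + (∫ y, y * (p (s + y) - p (s - y)) * h y) /
        ∫ y, (p (s + y) + p (s - y)) * h y := by
  obtain ⟨iB, eB⟩ := integral_symmetrized hp.integrable hh hsym hq s
  obtain ⟨iN, eN⟩ := integral_symmetrized hp.integrable_id_mul hh hsym hq s
  have hD := integral_mul_noise_pos hp hh hsym hq s
  have hA : (fun y => y * (p (s + y) - p (s - y)) * h y) = fun y =>
      ((s + y) * p (s + y) + (s - y) * p (s - y)) * h y - s * ((p (s + y) + p (s - y)) * h y) := by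
    ext y
    ring
  rw [hA]
  refine ⟨iN.sub (iB.const_mul s), ?_⟩
  rw [integral_sub iN (iB.const_mul s), integral_const_mul, eB, eN, postMean]
  field_simp
  ring

/-- The posterior mean is equivariant under reflection about the prior mean. -/
theorem postMean_reflect (hp : IsDensity p) (hpsym : SymmAbout μ p) (hh : IsDensity h)
    (hsym : SymmAbout 0 h) (hq : QuasiConcaveFn h) (s : ℝ) :
    postMean p h (2 * μ - s) = 2 * μ - postMean p h s := by
  have hr : ∀ x, p (2 * μ - x) = p x := fun x => by
    have := hpsym (μ - x)
    convert this using 2 <;> ring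
  have hn : ∀ x, h (2 * μ - s - (2 * μ - x)) = h (s - x) := fun x => by
    rw [← hsym.neg_eq]
    congr 1
    ring
  have hD := integral_mul_noise_pos hp hh hsym hq s
  have iD := integrable_mul_noise hp.integrable hh hsym hq s
  have iN := integrable_mul_noise hp.integrable_id_mul hh hsym hq s
  have eD : ∫ x, p x * h (2 * μ - s - x) = ∫ x, p x * h (s - x) := by
    rw [← integral_sub_left_eq_self _ volume (2 * μ)]
    simp only [hr, hn]
  have eN : ∫ x, x * p x * h (2 * μ - s - x) =
      2 * μ * (∫ x, p x * h (s - x)) - ∫ x, x * p x * h (s - x) := by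
    rw [← integral_sub_left_eq_self _ volume (2 * μ), ← integral_const_mul,
      ← integral_sub (iD.const_mul _) iN]
    simp only [hr, hn]
    congr 1 with x
    ring
  rw [postMean, postMean, eD, eN]
  field_simp

/-- The posterior mean does not fall below the prior mean when the signal exceeds it. -/
theorem le_postMean (hp : IsDensity p) (hpsym : SymmAbout μ p) (hh : IsDensity h)
    (hsym : SymmAbout 0 h) (hq : QuasiConcaveFn h) (hs : μ ≤ s) :
    μ ≤ postMean p h s := by
  have hD := integral_mul_noise_pos hp hh hsym hq s
  have iD := integrable_mul_noise hp.integrable hh hsym hq s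
  have iN := integrable_mul_noise hp.integrable_id_mul hh hsym hq s
  have iC : Integrable fun x => (x - μ) * p x * h (s - x) := by
    refine (iN.sub (iD.const_mul μ)).congr ?_
    filter_upwards with x
    simp only [Pi.sub_apply]
    ring
  have eC : ∫ x, (x - μ) * p x * h (s - x) =
      (∫ x, x * p x * h (s - x)) - μ * ∫ x, p x * h (s - x) := by
    rw [← integral_const_mul, ← integral_sub iN (iD.const_mul μ)]
    congr 1 with x
    ring
  have i1 := iC.comp_add_left μ
  have i2 := iC.comp_sub_left μ
  have e1 := integral_add_left_eq_self (μ := volume) (fun x => (x - μ) * p x * h (s - x)) μ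
  have e2 := integral_sub_left_eq_self (fun x => (x - μ) * p x * h (s - x)) volume μ
  have hnn : 0 ≤ ∫ z, ((μ + z - μ) * p (μ + z) * h (s - (μ + z)) +
      (μ - z - μ) * p (μ - z) * h (s - (μ - z))) := by
    refine integral_nonneg fun z => ?_
    have hz : (μ + z - μ) * p (μ + z) * h (s - (μ + z)) +
        (μ - z - μ) * p (μ - z) * h (s - (μ - z)) =
        p (μ + z) * (z * (h (s - μ - z) - h (s - μ + z))) := by
      rw [← hpsym z, show s - (μ + z) = s - μ - z by ring, show s - (μ - z) = s - μ + z by ring]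
      ring
    rw [Pi.zero_apply, hz]
    refine mul_nonneg (hp.1 _).le ?_
    rcases le_total 0 z with h0 | h0
    · exact mul_nonneg h0 (sub_nonneg.2 <| hq.le_of_abs_le hsym <|
        abs_le.2 ⟨by linarith, by linarith⟩)
    · exact mul_nonneg_of_nonpos_of_nonpos h0 (sub_nonpos.2 <| hq.le_of_abs_le hsym <|
        abs_le.2 ⟨by linarith, by linarith⟩)
  rw [integral_add i1 i2, e1, e2, eC] at hnn
  rw [postMean, le_div_iff₀ hD]
  linarith

/-- A density cannot be symmetric about a point other than its mean. -/
theorem IsDensity.eq_of_symmAbout (hp : IsDensity p) (hs : SymmAbout s p) :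
    ∫ x, x * p x = s := by
  have hr : ∀ x, p (2 * s - x) = p x := fun x => by
    have := hs (s - x)
    convert this using 2 <;> ring
  have e := integral_sub_left_eq_self (fun x => x * p x) volume (2 * s)
  simp only [hr, sub_mul] at e
  rw [integral_sub (hp.integrable.const_mul _) hp.integrable_id_mul, integral_const_mul,
    hp.2.2.1] at e
  linarith

theorem postMean_lt_postMean {f g : ℝ → ℝ}
    (hp : IsDensity p) (hpsym : SymmAbout μ p) (hplc : LogConcaveFn p) (hμ : μ = ∫ x, x * p x)
    (hf : IsDensity f) (hfsym : SymmAbout 0 f) (hfqc : QuasiConcaveFn f)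
    (hg : IsDensity g) (hgsym : SymmAbout 0 g) (hgqc : QuasiConcaveFn g)
    (hprec : StrictMonoOn (fun x => g x / f x) (Set.Ioi 0)) (hs : μ < s) :
    postMean p g s < postMean p f s := by
  obtain ⟨iAf, ef⟩ := postMean_eq_add_div hp hf hfsym hfqc s
  obtain ⟨iAg, eg⟩ := postMean_eq_add_div hp hg hgsym hgqc s
  obtain ⟨iBf, hBf⟩ := integral_symmetrized_density hp hf hfsym hfqc s
  obtain ⟨iBg, hBg⟩ := integral_symmetrized_density hp hg hgsym hgqc s
  have hpc := hp.continuous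
  have hfc := hf.continuous
  set A : ℝ → ℝ := fun y => y * (p (s + y) - p (s - y)) with hA
  set B : ℝ → ℝ := fun y => p (s + y) + p (s - y) with hB
  have hAc : Continuous A := by fun_prop
  have hBc : Continuous B := by fun_prop
  have hBpos : ∀ y, 0 < B y := fun y => add_pos (hp.1 _) (hp.1 _)
  have hAneg : ∀ y, A (-y) = A y := fun y => by
    simp only [hA, sub_neg_eq_add, ← sub_eq_add_neg]
    ring
  have hBneg : ∀ y, B (-y) = B y := fun y => by
    simp only [hB, sub_neg_eq_add, ← sub_eq_add_neg]
    ring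
  have hle : ∀ y, 0 ≤ y → p (s + y) ≤ p (s - y) := fun y hy => by
    have := hplc.mul_le_mul hp.1 hpsym hs.le hy
    rw [add_zero, sub_zero, mul_comm] at this
    exact le_of_mul_le_mul_left this (hp.1 s)
  have hA0 : ∀ y, A y ≤ 0 := fun y => by
    rcases le_total 0 y with hy | hy
    · exact mul_nonpos_of_nonneg_of_nonpos hy (sub_nonpos.2 (hle y hy))
    · rw [← hAneg]
      exact mul_nonpos_of_nonneg_of_nonpos (neg_nonneg.2 hy)
        (sub_nonpos.2 (hle _ (neg_nonneg.2 hy)))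
  obtain ⟨y₁, hy₁⟩ : ∃ y, A y ≠ 0 := by
    by_contra! hall
    refine hs.ne (hμ.trans (hp.eq_of_symmAbout fun y => ?_))
    rcases eq_or_ne y 0 with rfl | hy
    · simp
    · exact sub_eq_zero.1 ((mul_eq_zero.1 (hall y)).resolve_left hy)
  have hAf : ∫ y, A y * f y < 0 := by
    rw [← neg_pos, ← integral_neg]
    exact integral_pos_of_integrable_nonneg_nonzero (x := y₁) (hAc.mul hfc).neg iAf.neg
      (fun y => neg_nonneg.2 (mul_nonpos_of_nonpos_of_nonneg (hA0 y) (hf.1 y).le))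
      (neg_ne_zero.2 (mul_ne_zero hy₁ (hf.1 y₁).ne'))
  set c := (∫ y, A y * f y) / ∫ y, B y * f y with hc
  have hc0 : c < 0 := div_neg_of_neg_of_pos hAf hBf
  have hcm : c * ∫ y, B y * f y = ∫ y, A y * f y := div_mul_cancel₀ _ hBf.ne'
  have hAB0 : 0 < A 0 - c * B 0 := by
    have := mul_neg_of_neg_of_pos hc0 (hBpos 0)
    simp only [hA, zero_mul]
    linarith
  have iF : Integrable fun y => (A y - c * B y) * f y := by
    refine (iAf.sub (iBf.const_mul c)).congr ?_
    filter_upwards with x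
    simp only [Pi.sub_apply]
    ring
  have iG : Integrable fun y => (A y - c * B y) * g y := by
    refine (iAg.sub (iBg.const_mul c)).congr ?_
    filter_upwards with x
    simp only [Pi.sub_apply]
    ring
  have eF : ∫ y, (A y - c * B y) * f y = 0 := by
    simp only [sub_mul, mul_assoc c]
    rw [integral_sub iAf (iBf.const_mul c), integral_const_mul, hcm, sub_self]
  have eG : ∫ y, (A y - c * B y) * g y = (∫ y, A y * g y) - c * ∫ y, B y * g y := by
    simp only [sub_mul, mul_assoc c]
    rw [integral_sub iAg (iBg.const_mul c), integral_const_mul]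
  have hFc : Continuous fun y => A y - c * B y := by fun_prop
  obtain ⟨y₀, hy₀, hzero⟩ : ∃ y, 0 < y ∧ A y - c * B y = 0 := by
    obtain ⟨y, hy⟩ : ∃ y, A y - c * B y = 0 := by
      by_contra! hne
      have hpos : ∀ y, 0 < A y - c * B y := fun y => by
        by_contra! hy
        obtain ⟨z, hz⟩ := mem_range_of_exists_le_of_exists_ge hFc ⟨y, hy⟩ ⟨0, hAB0.le⟩
        exact hne z hz
      have := integral_pos_of_integrable_nonneg_nonzero (x := 0) (μ := volume)
        (hFc.mul hfc) iF (fun y => (mul_pos (hpos y) (hf.1 y)).le)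
        (mul_pos (hpos 0) (hf.1 0)).ne'
      exact this.ne' eF
    rcases lt_trichotomy y 0 with h0 | rfl | h0
    · exact ⟨-y, neg_pos.2 h0, by rw [hAneg, hBneg, hy]⟩
    · exact absurd hy hAB0.ne'
    · exact ⟨y, h0, hy⟩
  set lam := g y₀ / f y₀ with hlam
  have hk0 : p (s + y₀) - p (s - y₀) < 0 := by
    have h1 : y₀ * (p (s + y₀) - p (s - y₀)) < 0 := by
      have := mul_neg_of_neg_of_pos hc0 (hBpos y₀)
      change A y₀ < 0
      linarith
    exact (pos_iff_neg_of_mul_neg h1).1 hy₀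
  have hneg : ∀ y, 0 < y → y ≠ y₀ → (A y - c * B y) * (g y - lam * f y) < 0 := by
    intro y hy hne
    have hB₀ := hBpos y₀
    have hBy := hBpos y
    rcases hne.lt_or_gt with hlt | hgt
    · have hm := hplc.mul_le_mul hp.1 hpsym hs.le hlt.le
      have hr : g y / f y < lam := hprec hy hy₀ hlt
      rw [div_lt_iff₀ (hf.1 y)] at hr
      refine mul_neg_of_pos_of_neg (pos_of_mul_pos_left (b := B y₀) ?_ hB₀.le) (by linarith)
      have h1 : y * ((p (s + y₀) - p (s - y₀)) * B y) ≤
          y * ((p (s + y) - p (s - y)) * B y₀) :=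
        mul_le_mul_of_nonneg_left (by simp only [hB]; linarith) hy.le
      have h2 : y₀ * ((p (s + y₀) - p (s - y₀)) * B y) <
          y * ((p (s + y₀) - p (s - y₀)) * B y) :=
        mul_lt_mul_of_neg_right hlt (mul_neg_of_neg_of_pos hk0 hBy)
      have h3 : y₀ * (p (s + y₀) - p (s - y₀)) * B y = c * B y₀ * B y :=
        congrArg (· * B y) (sub_eq_zero.1 hzero)
      have h4 : A y = y * (p (s + y) - p (s - y)) := rfl
      rw [h4]
      linarith
    · have hm := hplc.mul_le_mul hp.1 hpsym hs.le hgt.le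
      have hr : lam < g y / f y := hprec hy₀ hy hgt
      rw [lt_div_iff₀ (hf.1 y)] at hr
      refine mul_neg_of_neg_of_pos (neg_of_mul_neg_left (b := B y₀) ?_ hB₀.le) (by linarith)
      have h1 : y * ((p (s + y) - p (s - y)) * B y₀) ≤
          y * ((p (s + y₀) - p (s - y₀)) * B y) :=
        mul_le_mul_of_nonneg_left (by simp only [hB]; linarith) hy.le
      have h2 : y * ((p (s + y₀) - p (s - y₀)) * B y) <
          y₀ * ((p (s + y₀) - p (s - y₀)) * B y) :=
        mul_lt_mul_of_neg_right hgt (mul_neg_of_neg_of_pos hk0 hBy)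
      have h3 : y₀ * (p (s + y₀) - p (s - y₀)) * B y = c * B y₀ * B y :=
        congrArg (· * B y) (sub_eq_zero.1 hzero)
      have h4 : A y = y * (p (s + y) - p (s - y)) := rfl
      rw [h4]
      linarith
  have hae : ∀ᵐ y, (A y - c * B y) * (g y - lam * f y) < 0 := by
    have hfin : ({0, y₀, -y₀} : Set ℝ).Finite := by simp
    filter_upwards [hfin.countable.ae_notMem volume] with y hy
    simp only [mem_insert_iff, mem_singleton_iff, not_or] at hy
    obtain ⟨h0, h1, h2⟩ := hy
    rcases lt_or_gt_of_ne h0 with h | h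
    · have := hneg (-y) (neg_pos.2 h) fun he => h2 (by linarith)
      rwa [hAneg, hBneg, hfsym.neg_eq, hgsym.neg_eq] at this
    · exact hneg y h h1
  have iH : Integrable fun y => (A y - c * B y) * (g y - lam * f y) := by
    refine (iG.sub (iF.const_mul lam)).congr ?_
    filter_upwards with x
    simp only [Pi.sub_apply]
    ring
  have eH : ∫ y, (A y - c * B y) * (g y - lam * f y) = ∫ y, (A y - c * B y) * g y := by
    rw [← sub_zero (∫ y, (A y - c * B y) * g y), ← mul_zero lam, ← eF, ← integral_const_mul,
      ← integral_sub iG (iF.const_mul lam)]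
    congr 1 with y
    ring
  have hH : ∫ y, (A y - c * B y) * (g y - lam * f y) < 0 := by
    have hnn : 0 ≤ᵐ[volume] fun y => -((A y - c * B y) * (g y - lam * f y)) := by
      filter_upwards [hae] with y hy using neg_nonneg.2 hy.le
    have h0 := integral_nonneg_of_ae hnn
    refine lt_of_le_of_ne (by rw [integral_neg] at h0; linarith) fun he => ?_
    rw [← neg_eq_zero, ← integral_neg, integral_eq_zero_iff_of_nonneg_ae hnn iH.neg] at he
    obtain ⟨y, hy1, hy2⟩ := (hae.and he).exists
    simp only [Pi.zero_apply, neg_eq_zero] at hy2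
    exact hy1.ne hy2
  rw [eH, eG] at hH
  rw [ef, eg]
  have : (∫ y, A y * g y) / ∫ y, B y * g y < c := by
    rw [div_lt_iff₀ hBg]
    linarith
  linarith

end Posterior

/-- Strict version of Theorem 1. -/
theorem imprecision_attenuates_updating_strict
    (fX f g : ℝ → ℝ) (μ : ℝ)
    (hfX : IsDensity fX) (hfXsym : SymmAbout μ fX) (hfXlc : LogConcaveFn fX)
    (hμ : μ = ∫ x, x * fX x)
    (hf : IsDensity f) (hfsym : SymmAbout 0 f) (hfqc : QuasiConcaveFn f)
    (hg : IsDensity g) (hgsym : SymmAbout 0 g) (hgqc : QuasiConcaveFn g)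
    (hprec : StrictMonoOn (fun x => g x / f x) (Set.Ioi 0)) :
    (∀ s, μ < s → postMean fX g s < postMean fX f s ∧ μ ≤ postMean fX g s) ∧
    (∀ s, s < μ → postMean fX f s < postMean fX g s ∧ postMean fX g s ≤ μ) := by
  refine ⟨fun s hs => ⟨postMean_lt_postMean hfX hfXsym hfXlc hμ hf hfsym hfqc hg hgsym hgqc
    hprec hs, le_postMean hfX hfXsym hg hgsym hgqc hs.le⟩, fun s hs => ?_⟩
  have hs' : μ < 2 * μ - s := by linarith
  have h1 := postMean_lt_postMean hfX hfXsym hfXlc hμ hf hfsym hfqc hg hgsym hgqc hprec hs'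
  have h2 := le_postMean hfX hfXsym hg hgsym hgqc hs'.le
  rw [postMean_reflect hfX hfXsym hg hgsym hgqc] at h1 h2
  rw [postMean_reflect hfX hfXsym hf hfsym hfqc] at h1
  exact ⟨by linarith, by linarith⟩
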